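/- Let N ≥ 2, let L and L̃ be N×N complex matrices and ε ∈ ℂ, and suppose there exists a linear subspace V of ℂ^N with dim V ≥ N − 2 such that L·v = 0 and L̃·v = 0 for all v ∈ V. Set t = Tr(L), p = Tr(L²), s = Tr(L̃), u = Tr(L̃²), q = Tr(L·L̃). Then for every μ ∈ ℂ, det( (μ + ε)·(μ·I_N − L) − L̃ ) = ( μ·(μ + ε) )^{N−2} · Q(μ), where Q(μ) = μ⁴ + (2ε − t)·μ³ + ( ε² − 2ε·t + (t² − p)/2 − s )·μ² + ( t·s − q + ε·(t² − p − s) − ε²·t )·μ + ( s² − u + 2ε·(t·s − q) + ε²·(t² − p) )/2. -/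

import Mathlib

open Matrix

/-- A matrix of rank at most `k` factors through `Fin k`. -/
theorem Matrix.exists_eq_mul_of_rank_le {K m n : Type*} [Field K] [Fintype m] [Fintype n]
    [DecidableEq n] (M : Matrix m n K) {k : ℕ} (hM : M.rank ≤ k) :
    ∃ (A : Matrix m (Fin k) K) (B : Matrix (Fin k) n K), M = A * B := by
  obtain ⟨f, hf⟩ : ∃ f : LinearMap.range M.mulVecLin →ₗ[K] (Fin k → K), Function.Injective f :=
    finrank_le_iff_exists_linearMap.mp (by simpa [Matrix.rank] using hM)
  obtain ⟨g, hg⟩ := f.exists_leftInverse_of_injective (LinearMap.ker_eq_bot.mpr hf)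
  refine ⟨LinearMap.toMatrix' ((LinearMap.range M.mulVecLin).subtype ∘ₗ g),
    LinearMap.toMatrix' (f ∘ₗ M.mulVecLin.rangeRestrict), ?_⟩
  rw [← LinearMap.toMatrix'_comp, LinearMap.comp_assoc, ← LinearMap.comp_assoc _ f g, hg,
    LinearMap.id_comp, LinearMap.subtype_comp_codRestrict, ← Matrix.toLin'_apply',
    LinearMap.toMatrix'_toLin']

/-- The rank of a matrix annihilating a subspace is at most the codimension of the subspace. -/
theorem Matrix.rank_add_finrank_le_of_mulVec_eq_zero {K m n : Type*} [Field K] [Fintype m]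
    [Fintype n] (M : Matrix m n K) (V : Submodule K (n → K))
    (hV : ∀ v ∈ V, M.mulVec v = 0) :
    M.rank + Module.finrank K V ≤ Fintype.card n := by
  have hker : V ≤ LinearMap.ker M.mulVecLin := fun v hv ↦ by simpa using hV v hv
  calc M.rank + Module.finrank K V
      ≤ M.rank + Module.finrank K (LinearMap.ker M.mulVecLin) := by
        gcongr
        exact Submodule.finrank_mono hker
    _ = Fintype.card n := by
        rw [Matrix.rank, LinearMap.finrank_range_add_finrank_ker, Module.finrank_pi]

/-- The characteristic determinant of a matrix of rank at most two. -/
theorem Matrix.det_smul_one_sub_of_rank_le_two {K n : Type*} [Field K] [NeZero (2 : K)]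
    [Fintype n] [DecidableEq n] (M : Matrix n n K) (hM : M.rank ≤ 2)
    (hn : 2 ≤ Fintype.card n) (x : K) :
    (x • (1 : Matrix n n K) - M).det =
      x ^ (Fintype.card n - 2) *
        (x ^ 2 - M.trace * x + (M.trace ^ 2 - (M * M).trace) / 2) := by
  obtain ⟨A, B, rfl⟩ := M.exists_eq_mul_of_rank_le hM
  have htrace : (A * B * (A * B)).trace = (B * A * (B * A)).trace := by
    rw [Matrix.mul_assoc, Matrix.trace_mul_comm, Matrix.mul_assoc, Matrix.mul_assoc,
      Matrix.mul_assoc]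
  have hdet : ((B * A).trace ^ 2 - (B * A * (B * A)).trace) / 2 = (B * A).det := by
    generalize B * A = D
    rw [div_eq_iff (NeZero.ne (2 : K))]
    simp only [Matrix.trace_fin_two, Matrix.det_fin_two, Matrix.mul_apply, Fin.sum_univ_two]
    ring
  rw [Matrix.smul_one_eq_diagonal, ← Matrix.scalar_apply, ← Matrix.eval_charpoly,
    Matrix.charpoly_mul_comm_of_le A B (by simpa using hn), Matrix.charpoly_fin_two, htrace,
    Matrix.trace_mul_comm A B, hdet]
  simp

/-- Let `N ≥ 2`, let `L, L̃` be `N × N` complex matrices annihilating a common subspace `V` of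
dimension at least `N - 2`, and `ε ∈ ℂ`. With `t = Tr L`, `p = Tr L²`, `s = Tr L̃`,
`u = Tr L̃²`, `q = Tr(L L̃)`, one has for every `μ ∈ ℂ`:
`det((μ+ε)(μ Iₙ - L) - L̃) = (μ(μ+ε))^(N-2) · Q(μ)` with the explicit quartic `Q`. -/
theorem adaptive_splay_determinant_factorization (N : ℕ) (hN : 2 ≤ N)
    (L Lt : Matrix (Fin N) (Fin N) ℂ) (ε : ℂ)
    (V : Submodule ℂ (Fin N → ℂ)) (hVdim : N - 2 ≤ Module.finrank ℂ V)
    (hV : ∀ v ∈ V, L.mulVec v = 0 ∧ Lt.mulVec v = 0)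
    (t p s u q : ℂ)
    (ht : t = L.trace) (hp : p = (L * L).trace) (hs : s = Lt.trace)
    (hu : u = (Lt * Lt).trace) (hq : q = (L * Lt).trace) :
    ∀ μ : ℂ,
      ((μ + ε) • (μ • (1 : Matrix (Fin N) (Fin N) ℂ) - L) - Lt).det =
        (μ * (μ + ε)) ^ (N - 2) *
          (μ ^ 4 + (2 * ε - t) * μ ^ 3
            + (ε ^ 2 - 2 * ε * t + (t ^ 2 - p) / 2 - s) * μ ^ 2
            + (t * s - q + ε * (t ^ 2 - p - s) - ε ^ 2 * t) * μ
            + (s ^ 2 - u + 2 * ε * (t * s - q) + ε ^ 2 * (t ^ 2 - p)) / 2) := by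
  intro μ
  set M := (μ + ε) • L + Lt with hM
  have hrank : M.rank ≤ 2 := by
    have h := M.rank_add_finrank_le_of_mulVec_eq_zero V fun v hv ↦ by
      simp [hM, Matrix.add_mulVec, Matrix.smul_mulVec, hV v hv]
    rw [Fintype.card_fin] at h
    omega
  have hmatrix : (μ + ε) • (μ • (1 : Matrix (Fin N) (Fin N) ℂ) - L) - Lt =
      (μ * (μ + ε)) • (1 : Matrix (Fin N) (Fin N) ℂ) - M := by
    rw [hM]
    module
  have htrace : M.trace = (μ + ε) * t + s := by
    simp [hM, ht, hs]
  have htrace_sq : (M * M).trace = (μ + ε) ^ 2 * p + 2 * (μ + ε) * q + u := by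
    simp only [hM, hp, hq, hu, Matrix.add_mul, Matrix.mul_add, Matrix.smul_mul, Matrix.mul_smul,
      Matrix.trace_add, Matrix.trace_smul, smul_eq_mul, Matrix.trace_mul_comm Lt L]
    ring
  rw [hmatrix, M.det_smul_one_sub_of_rank_le_two hrank (by simpa using hN), htrace, htrace_sq,
    Fintype.card_fin]
  ring
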